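/- Let k ≥ 1 be an integer and set β = 1 − 2^{−(k+1)}. Define f(β) := limsup_{n→∞} log(e_{⌊n^β⌋}(n))/log(n). Then f(β) = 1. -/

import Mathlib

open Filter

/-- A finite subset `S` of the `n`-dimensional hypercube (binary sequences of
length `n`) is `d`-equilateral if it is nonempty and any two distinct points
have Hamming distance exactly `d`. -/
def IsEquilateralSet {n : ℕ} (d : ℕ) (S : Finset (Fin n → Bool)) : Prop :=
  S.Nonempty ∧ ∀ x ∈ S, ∀ y ∈ S, x ≠ y → hammingDist x y = d

/-- `equilateralDim d n` is the maximal size of a `d`-equilateral subset of the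
`n`-dimensional hypercube. -/
noncomputable def equilateralDim (d n : ℕ) : ℕ :=
  sSup {m : ℕ | ∃ S : Finset (Fin n → Bool), IsEquilateralSet d S ∧ S.card = m}

theorem IsEquilateralSet.card_le {n d : ℕ} {S : Finset (Fin n → Bool)}
    (hS : IsEquilateralSet d S) : S.card ≤ 2 * n + 1 := by
  rcases le_or_gt S.card 1 with h1 | h1
  · omega
  obtain ⟨a, ha, b, hb, hab⟩ := Finset.one_lt_card.mp h1
  have hdn : d ≤ n := by
    have h := hammingDist_le_card_fintype (x := a) (y := b)
    rwa [hS.2 a ha b hb hab, Fintype.card_fin] at h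
  have hd : 0 < d := by
    rw [← hS.2 a ha b hb hab]
    exact hammingDist_pos.mpr hab
  let w : S → (Fin n × Bool → ℝ) := fun x p => if x.1 p.1 = p.2 then 1 else 0
  have gram (x y : S) : ∑ p, w x p * w y p = ((n : ℝ) - d) + if x = y then (d : ℝ) else 0 := by
    have h : ∑ p, w x p * w y p = (n : ℝ) - hammingDist x.1 y.1 := by
      have h2 : (n : ℝ) = ∑ i : Fin n, 1 := by simp
      have h3 : (hammingDist x.1 y.1 : ℝ) = ∑ i, if x.1 i ≠ y.1 i then (1 : ℝ) else 0 := by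
        rw [hammingDist, Finset.sum_boole]
      rw [h2, h3, ← Finset.sum_sub_distrib, Fintype.sum_prod_type]
      refine Finset.sum_congr rfl fun i _ => ?_
      simp only [w, Fintype.sum_bool]
      cases x.1 i <;> cases y.1 i <;> simp
    rw [h]
    split_ifs with hxy
    · simp [hxy]
    · rw [hS.2 x x.2 y y.2 fun e => hxy (Subtype.ext e)]
      ring
  have hli : LinearIndependent ℝ w := by
    rw [Fintype.linearIndependent_iff]
    intro c hc
    have key (y : S) : ((n : ℝ) - d) * ∑ x, c x + d * c y = 0 := by
      have h0 : ∑ p, (∑ x, c x • w x) p * w y p = 0 := by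
        rw [hc]
        simp
      have h1 : ∑ p, (∑ x, c x • w x) p * w y p = ∑ x, c x * ∑ p, w x p * w y p := by
        simp only [Finset.sum_apply, Pi.smul_apply, smul_eq_mul, Finset.sum_mul, Finset.mul_sum]
        rw [Finset.sum_comm]
        simp only [mul_assoc]
      rw [h1] at h0
      simp only [gram, mul_add, Finset.sum_add_distrib, ← Finset.sum_mul, mul_ite, mul_zero,
        Finset.sum_ite_eq', Finset.mem_univ, if_true] at h0
      linarith
    have hsq : ((n : ℝ) - d) * (∑ x, c x) ^ 2 + d * ∑ y, c y ^ 2 = 0 := by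
      calc _ = ∑ y, c y * (((n : ℝ) - d) * ∑ x, c x + d * c y) := by
            simp only [mul_add, Finset.sum_add_distrib, ← Finset.sum_mul]
            rw [Finset.mul_sum]
            congr 1
            · ring
            · exact Finset.sum_congr rfl fun y _ => by ring
        _ = 0 := Finset.sum_eq_zero fun y _ => by rw [key, mul_zero]
    have hd' : (0 : ℝ) < d := by exact_mod_cast hd
    have hdn' : (0 : ℝ) ≤ (n : ℝ) - d := sub_nonneg.mpr (by exact_mod_cast hdn)
    have hz : ∑ y, c y ^ 2 = 0 := by
      have h1 : 0 ≤ ∑ y, c y ^ 2 := Finset.sum_nonneg fun y _ => sq_nonneg _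
      nlinarith [mul_nonneg hdn' (sq_nonneg (∑ x, c x)), mul_nonneg hd'.le h1]
    intro y
    exact pow_eq_zero_iff two_ne_zero |>.mp <|
      (Finset.sum_eq_zero_iff_of_nonneg fun y _ => sq_nonneg (c y)).mp hz y (Finset.mem_univ y)
  have h := hli.fintype_card_le_finrank
  simp at h
  omega

theorem equilateralDim_le (d n : ℕ) : equilateralDim d n ≤ 2 * n + 1 :=
  csSup_le' fun _ ⟨_, hS, hm⟩ => hm ▸ hS.card_le

theorem IsEquilateralSet.card_le_equilateralDim {n d : ℕ} {S : Finset (Fin n → Bool)}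
    (hS : IsEquilateralSet d S) : S.card ≤ equilateralDim d n :=
  le_csSup ⟨2 * n + 1, fun _ ⟨_, hT, hm⟩ => hm ▸ hT.card_le⟩ ⟨S, hS, rfl⟩

theorem hammingDist_sumElim {ι κ α : Type*} [Fintype ι] [Fintype κ] [DecidableEq α]
    (f f' : ι → α) (g g' : κ → α) :
    hammingDist (Sum.elim f g) (Sum.elim f' g') = hammingDist f f' + hammingDist g g' := by
  simp only [hammingDist, Finset.card_filter, Fintype.sum_sum_type, Sum.elim_inl, Sum.elim_inr]
  rfl

/-- One-hot encoding of a word over the alphabet `α` doubles Hamming distances. -/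
theorem hammingDist_oneHot {ι α : Type*} [Fintype ι] [Fintype α] [DecidableEq α] (f g : ι → α) :
    hammingDist (fun p : ι × α => decide (f p.1 = p.2)) (fun p => decide (g p.1 = p.2)) =
      2 * hammingDist f g := by
  simp only [hammingDist, Finset.card_filter, Fintype.sum_prod_type, Finset.mul_sum]
  refine Finset.sum_congr rfl fun i _ => ?_
  rw [← Finset.card_filter]
  split_ifs with h
  · rw [mul_one, ← Finset.card_pair h]
    congr 1
    ext c
    simp only [ne_eq, decide_eq_decide, Finset.mem_filter, Finset.mem_univ, true_and,
      Finset.mem_insert, Finset.mem_singleton]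
    grind
  · push Not at h
    simp [h]

theorem hammingDist_extend_embedding {ι κ : Type*} [Fintype ι] [Fintype κ] (e : ι ↪ κ)
    (f g : ι → Bool) :
    hammingDist (Function.extend e f fun _ => false) (Function.extend e g fun _ => false) =
      hammingDist f g := by
  classical
  rw [hammingDist, hammingDist, ← Finset.card_map e]
  congr 1
  ext j
  simp only [Finset.mem_filter, Finset.mem_univ, true_and, Finset.mem_map]
  constructor
  · intro h
    by_cases hj : ∃ i, e i = j
    · obtain ⟨i, rfl⟩ := hj
      exact ⟨i, by simpa [e.injective.extend_apply] using h, rfl⟩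
    · simp [Function.extend_apply' _ _ _ hj] at h
  · rintro ⟨i, hi, rfl⟩
    simpa [e.injective.extend_apply] using hi

/-- A nonconstant affine form on `F ^ (m + 1)` is nonzero at `q ^ (m + 1) - q ^ m` points. -/
theorem card_affine_ne_zero {F : Type*} [Field F] [Fintype F] [DecidableEq F] {m : ℕ}
    (a : Fin (m + 1) → F) (ha : a ≠ 0) (c : F) :
    (Finset.univ.filter fun x : Fin (m + 1) → F => c + a ⬝ᵥ x ≠ 0).card +
      Fintype.card F ^ m = Fintype.card F ^ (m + 1) := by
  have hz : (Finset.univ.filter fun x : Fin (m + 1) → F => c + a ⬝ᵥ x = 0).card =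
      Fintype.card F ^ m := by
    obtain ⟨i, hi⟩ := Function.ne_iff.mp ha
    have hi' : a i ≠ 0 := hi
    have hsum (x : Fin (m + 1) → F) :
        a ⬝ᵥ x = a i * x i + ∑ j, a (i.succAbove j) * x (i.succAbove j) := by
      rw [dotProduct, Fin.sum_univ_succAbove _ i]
    have hcard : Fintype.card F ^ m = (Finset.univ : Finset (Fin m → F)).card := by simp
    rw [hcard]
    refine Finset.card_bij' (fun x _ => i.removeNth x)
      (fun y _ => i.insertNth (-(c + ∑ j, a (i.succAbove j) * y j) / a i) y) ?_ ?_ ?_ ?_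
    · simp
    · intro y _
      simp only [Finset.mem_filter, Finset.mem_univ, true_and, hsum, Fin.insertNth_apply_same,
        Fin.insertNth_apply_succAbove]
      field_simp
      ring
    · intro x hx
      simp only [Finset.mem_filter, Finset.mem_univ, true_and, hsum] at hx
      rw [Fin.insertNth_eq_iff]
      refine ⟨?_, rfl⟩
      rw [div_eq_iff hi']
      simp only [Fin.removeNth]
      linear_combination -hx
    · intro y _
      simp
  have h := Finset.card_filter_add_card_filter_not (s := Finset.univ)
    (fun x : Fin (m + 1) → F => c + a ⬝ᵥ x = 0)
  rw [hz] at h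
  simp at h
  simp only [ne_eq]
  omega

/-- The simplex code of dimension `m + 1` over `F`: all distances are `q ^ m`. -/
theorem exists_simplexCode (F : Type) [Field F] [Fintype F] [DecidableEq F] (m : ℕ) :
    ∃ (ι : Type) (_ : Fintype ι) (C : (Fin (m + 1) → F) → ι → F),
      Fintype.card ι ≤ 2 * Fintype.card F ^ m ∧
      ∀ a b, a ≠ b → hammingDist (C a) (C b) = Fintype.card F ^ m := by
  induction m with
  | zero =>
    refine ⟨Unit, inferInstance, fun a _ => a 0, by simp, fun a b hab => ?_⟩
    have h : a 0 ≠ b 0 := fun h => hab (funext fun i => by rwa [Fin.fin_one_eq_zero i])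
    simp [hammingDist, h]
  | succ m ih =>
    obtain ⟨ι, _, C, hι, hC⟩ := ih
    refine ⟨(Fin (m + 1) → F) ⊕ ι, inferInstance,
      fun a => Sum.elim (fun x => a 0 + Fin.tail a ⬝ᵥ x) (C (Fin.tail a)), ?_, fun a b hab => ?_⟩
    · have hq : 2 ≤ Fintype.card F := Fintype.one_lt_card
      have := Nat.mul_le_mul_right (Fintype.card F ^ m) hq
      simp only [Fintype.card_sum, Fintype.card_pi, Finset.prod_const, Finset.card_univ,
        Fintype.card_fin]
      rw [pow_succ']
      omega
    · rw [hammingDist_sumElim]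
      have hdist : hammingDist (fun x => a 0 + Fin.tail a ⬝ᵥ x) (fun x => b 0 + Fin.tail b ⬝ᵥ x) =
          (Finset.univ.filter fun x : Fin (m + 1) → F =>
            (a 0 - b 0) + (Fin.tail a - Fin.tail b) ⬝ᵥ x ≠ 0).card := by
        rw [hammingDist]
        congr 1
        ext x
        simp only [Finset.mem_filter, Finset.mem_univ, true_and, sub_dotProduct]
        rw [not_iff_not, ← sub_eq_zero, add_sub_add_comm]
      by_cases ht : Fin.tail a = Fin.tail b
      · have h0 : a 0 - b 0 ≠ 0 := fun h => hab <| by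
          rw [← Fin.cons_self_tail a, ← Fin.cons_self_tail b, ht, sub_eq_zero.mp h]
        rw [hdist, ht]
        simp [h0]
      · rw [hdist, hC _ _ ht, card_affine_ne_zero _ (sub_ne_zero.mpr ht)]

theorem pow_succ_le_equilateralDim {q m n : ℕ} (hq : q.Prime) (hn : 2 * q ^ (m + 1) ≤ n) :
    q ^ (m + 1) ≤ equilateralDim (2 * q ^ m) n := by
  classical
  have := Fact.mk hq
  obtain ⟨ι, _, C, hι, hC⟩ := exists_simplexCode (ZMod q) m
  rw [ZMod.card] at hι hC
  have hle : Fintype.card (ι × ZMod q) ≤ Fintype.card (Fin n) := by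
    rw [Fintype.card_prod, ZMod.card, Fintype.card_fin]
    calc _ ≤ 2 * q ^ m * q := Nat.mul_le_mul_right _ hι
      _ = 2 * q ^ (m + 1) := by ring
      _ ≤ n := hn
  obtain ⟨e⟩ := Function.Embedding.nonempty_of_card_le hle
  let B : (Fin (m + 1) → ZMod q) → Fin n → Bool := fun a =>
    Function.extend e (fun p => decide (C a p.1 = p.2)) fun _ => false
  have hB (a b) (hab : a ≠ b) : hammingDist (B a) (B b) = 2 * q ^ m := by
    rw [hammingDist_extend_embedding, hammingDist_oneHot, hC a b hab]
  have hinj : Function.Injective B := fun a b h => by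
    by_contra hab
    have h2 := hB a b hab
    rw [h, hammingDist_self] at h2
    have := pow_pos hq.pos m
    omega
  have hS : IsEquilateralSet (2 * q ^ m) (Finset.univ.image B) := by
    refine ⟨Finset.univ_nonempty.image B, ?_⟩
    simp only [Finset.mem_image, Finset.mem_univ, true_and]
    rintro _ ⟨a, rfl⟩ _ ⟨b, rfl⟩ hne
    exact hB a b fun h => hne (h ▸ rfl)
  have h := hS.card_le_equilateralDim
  rw [Finset.card_image_of_injective _ hinj] at h
  simpa [ZMod.card] using h

theorem tendsto_log_const_mul_div_log {c : ℝ} (hc : 0 < c) :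
    Tendsto (fun n : ℕ => Real.log (c * n) / Real.log n) atTop (nhds 1) := by
  have hlog : Tendsto (fun n : ℕ => Real.log n) atTop atTop :=
    Real.tendsto_log_atTop.comp tendsto_natCast_atTop_atTop
  have h : Tendsto (fun n : ℕ => Real.log c / Real.log n + 1) atTop (nhds (0 + 1)) :=
    (hlog.const_div_atTop _).add_const 1
  rw [zero_add] at h
  refine h.congr' ?_
  filter_upwards [eventually_gt_atTop 1] with n hn
  have h1 : (1 : ℝ) < n := by exact_mod_cast hn
  rw [Real.log_mul hc.ne' (by positivity), add_div, div_self (Real.log_pos h1).ne']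

/-- For `β = m / (m + 1)` the rounded power `⌊n ^ β⌋` equals `2 * q ^ m` for a suitable
`n` between `2 * q ^ (m + 1)` and `5 * q ^ (m + 1)`. -/
theorem exists_floor_rpow_eq {m q : ℕ} (hm : 1 ≤ m) (hq : 1 ≤ q) {β : ℝ}
    (hβ : β * (m + 1) = m) :
    ∃ n : ℕ, 2 * q ^ (m + 1) ≤ n ∧ n ≤ 5 * q ^ (m + 1) ∧ ⌊(n : ℝ) ^ β⌋₊ = 2 * q ^ m := by
  have hm' : (1 : ℝ) ≤ m := by exact_mod_cast hm
  have hq' : (1 : ℝ) ≤ q := by exact_mod_cast hq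
  have hβ2 : 1 / 2 ≤ β := by nlinarith
  have hβ0 : 0 < β := by linarith
  have hβ1 : β ≤ 1 := by nlinarith
  have hpow : ((q : ℝ) ^ (m + 1)) ^ β = (q : ℝ) ^ m := by
    rw [← Real.rpow_natCast, ← Real.rpow_mul (by positivity), ← Real.rpow_natCast (q : ℝ) m]
    congr 1
    push_cast
    linarith
  set d : ℝ := 2 * (q : ℝ) ^ m with hd
  have hd0 : 0 < d := by positivity
  set t : ℝ := d ^ β⁻¹ with ht
  have ht0 : 0 < t := by positivity
  have htβ : t ^ β = d := Real.rpow_inv_rpow hd0.le hβ0.ne'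
  have hlow : 2 * (q : ℝ) ^ (m + 1) ≤ t := by
    rw [ht, Real.le_rpow_inv_iff_of_pos (by positivity) hd0.le hβ0,
      Real.mul_rpow (by norm_num) (by positivity), hpow, hd]
    gcongr
    exact Real.rpow_le_self_of_one_le (by norm_num) hβ1
  have hup : t ≤ 4 * (q : ℝ) ^ (m + 1) := by
    rw [ht, Real.rpow_inv_le_iff_of_pos hd0.le (by positivity) hβ0,
      Real.mul_rpow (by norm_num) (by positivity), hpow, hd]
    gcongr
    calc (2 : ℝ) = 4 ^ (1 / 2 : ℝ) := by
          rw [show (4 : ℝ) = 2 ^ (2 : ℝ) by norm_num, ← Real.rpow_mul (by norm_num)]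
          norm_num
      _ ≤ 4 ^ β := Real.rpow_le_rpow_of_exponent_le (by norm_num) hβ2
  refine ⟨⌈t⌉₊, ?_, ?_, ?_⟩
  · exact_mod_cast hlow.trans (Nat.le_ceil t)
  · refine Nat.ceil_le.mpr (hup.trans ?_)
    push_cast
    gcongr
    norm_num
  · have hge : d ≤ (⌈t⌉₊ : ℝ) ^ β := by
      rw [← htβ]
      exact Real.rpow_le_rpow ht0.le (Nat.le_ceil t) hβ0.le
    have hc1 : (1 : ℝ) ≤ ⌈t⌉₊ := by exact_mod_cast Nat.ceil_pos.mpr ht0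
    have hlt : (⌈t⌉₊ : ℝ) ^ β < d + 1 := by
      have h1 : (⌈t⌉₊ : ℝ) - 1 < t := by linarith [Nat.ceil_lt_add_one ht0.le]
      calc (⌈t⌉₊ : ℝ) ^ β = ((⌈t⌉₊ - 1 : ℝ) + 1) ^ β := by rw [sub_add_cancel]
        _ ≤ (⌈t⌉₊ - 1 : ℝ) ^ β + 1 ^ β :=
          Real.rpow_add_le_add_rpow (by linarith) zero_le_one hβ0.le hβ1
        _ < t ^ β + 1 ^ β := by
          gcongr
        _ = d + 1 := by rw [htβ, Real.one_rpow]
    rw [Nat.floor_eq_iff (by positivity)]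
    push_cast
    exact ⟨hge, hlt⟩

theorem frequently_le_equilateralDim {m : ℕ} (hm : 1 ≤ m) {β : ℝ} (hβ : β * (m + 1) = m) :
    ∃ᶠ n : ℕ in atTop, (1 / 5 : ℝ) * n ≤ equilateralDim ⌊(n : ℝ) ^ β⌋₊ n := by
  rw [frequently_atTop]
  intro N
  obtain ⟨q, hNq, hq⟩ := Nat.exists_infinite_primes N
  obtain ⟨n, hlow, hup, hfloor⟩ := exists_floor_rpow_eq hm hq.one_le hβ
  refine ⟨n, ?_, ?_⟩
  · have : q ≤ q ^ (m + 1) := Nat.le_self_pow (Nat.succ_ne_zero m) q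
    change N ≤ n
    omega
  · rw [hfloor]
    have h1 : (q : ℝ) ^ (m + 1) ≤ equilateralDim (2 * q ^ m) n := by
      exact_mod_cast pow_succ_le_equilateralDim hq hlow
    have h2 : (n : ℝ) ≤ 5 * (q : ℝ) ^ (m + 1) := by exact_mod_cast hup
    linarith

theorem limsup_equilateralDim_pow_beta (k : ℕ) (hk : 1 ≤ k) (β : ℝ)
    (hβ : β = 1 - 2 ^ (-(k + 1 : ℤ))) :
    limsup (fun n : ℕ =>
        Real.log (equilateralDim ⌊(n : ℝ) ^ β⌋₊ n) / Real.log n) atTop = 1 := by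
  have hβm : β * ((2 ^ (k + 1) - 1 : ℕ) + 1) = (2 ^ (k + 1) - 1 : ℕ) := by
    rw [hβ, zpow_neg, Nat.cast_sub Nat.one_le_two_pow]
    push_cast
    rw [show ((k : ℤ) + 1) = ((k + 1 : ℕ) : ℤ) by norm_num, zpow_natCast]
    field_simp
    ring
  have hm : 1 ≤ 2 ^ (k + 1) - 1 := by
    have := Nat.pow_le_pow_right two_pos (Nat.le_add_left 1 k)
    omega
  have hfreq := frequently_le_equilateralDim hm hβm
  set u : ℕ → ℝ := fun n => Real.log (equilateralDim ⌊(n : ℝ) ^ β⌋₊ n) / Real.log n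
  have hlim := tendsto_log_const_mul_div_log (c := 3) (by norm_num)
  have hle : u ≤ᶠ[atTop] fun n : ℕ => Real.log (3 * n) / Real.log n := by
    filter_upwards [eventually_ge_atTop 1] with n hn
    have hn' : (1 : ℝ) ≤ n := by exact_mod_cast hn
    refine div_le_div_of_nonneg_right ?_ (Real.log_nonneg hn')
    rcases Nat.eq_zero_or_pos (equilateralDim ⌊(n : ℝ) ^ β⌋₊ n) with h0 | h0
    · rw [h0, Nat.cast_zero, Real.log_zero]
      exact Real.log_nonneg (by linarith)
    · refine Real.log_le_log (by exact_mod_cast h0) ?_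
      have h : (equilateralDim ⌊(n : ℝ) ^ β⌋₊ n : ℝ) ≤ 2 * n + 1 := by
        exact_mod_cast equilateralDim_le _ n
      linarith
  have hnonneg (n : ℕ) : 0 ≤ u n :=
    div_nonneg (Real.log_natCast_nonneg _) (Real.log_natCast_nonneg _)
  have hbdd : IsBoundedUnder (· ≤ ·) atTop u := hlim.isBoundedUnder_le.mono_le hle
  refine le_antisymm ?_ (le_of_forall_lt fun a ha => ?_)
  · rw [← hlim.limsup_eq]
    exact limsup_le_limsup hle
      (isBoundedUnder_of ⟨0, hnonneg⟩ : IsBoundedUnder (· ≥ ·) atTop u).isCoboundedUnder_le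
      hlim.isBoundedUnder_le
  · obtain ⟨b, hab, hb⟩ := exists_between ha
    refine hab.trans_le (le_limsup_of_frequently_le ?_ hbdd)
    have hev := (tendsto_log_const_mul_div_log (c := 1 / 5) (by norm_num)).eventually_const_lt hb
    refine (hfreq.and_eventually (hev.and (eventually_ge_atTop 1))).mono ?_
    rintro n ⟨hn, hbn, hn1⟩
    have hn' : (1 : ℝ) ≤ n := by exact_mod_cast hn1
    refine hbn.le.trans (div_le_div_of_nonneg_right ?_ (Real.log_nonneg hn'))
    exact Real.log_le_log (by positivity) hn
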